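/- arXiv:1903.08854 — 8 statements merged into one kernel-verified Lean document; each statement's English description precedes it below -/
import Mathlib

section
/- Let 1 < p ≤ q be real numbers, a₀ ≥ 0, H₀(t) = t^p + a₀ t^q for t ≥ 0, and H₀*(t) = sup_{s>0}(s·t − H₀(s)). Then for every A ≥ 1 and every t ≥ 0 one has H₀*(A·t) ≤ A^{p/(p−1)} · H₀*(t). -/
/-- The values `s * t - (s ^ p + a * s ^ q)`, `s > 0`, are bounded above when `p > 1`. -/
theorem bddAbove_doublePhase_conjugate {p q a t : ℝ} (hp : 1 < p) (ha : 0 ≤ a) (ht : 0 ≤ t) :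
    BddAbove {y : ℝ | ∃ s : ℝ, 0 < s ∧ y = s * t - (s ^ p + a * s ^ q)} := by
  refine ⟨t ^ p.conjExponent / p.conjExponent, ?_⟩
  rintro y ⟨s, hs, rfl⟩
  have young := Real.young_inequality_of_nonneg hs.le ht (Real.HolderConjugate.conjExponent hp)
  have hsp : s ^ p / p ≤ s ^ p := div_le_self (by positivity) hp.le
  have hsq : 0 ≤ a * s ^ q := by positivity
  linarith

/-- Rescaling `s = A ^ (1 / (p - 1)) * r` in the supremum defining the conjugate. -/
theorem doublePhase_conjugate_term_le {p q a A r t : ℝ} (hp : 1 < p) (hpq : p ≤ q) (ha : 0 ≤ a)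
    (hA : 1 ≤ A) (hr : 0 < r) :
    A ^ (1 / (p - 1)) * r * (A * t) -
        ((A ^ (1 / (p - 1)) * r) ^ p + a * (A ^ (1 / (p - 1)) * r) ^ q) ≤
      A ^ (p / (p - 1)) * (r * t - (r ^ p + a * r ^ q)) := by
  have hA0 : 0 < A := by linarith
  have hp1 : p - 1 ≠ 0 := by linarith
  set B := A ^ (1 / (p - 1)) with hB
  have hB1 : 1 ≤ B := Real.one_le_rpow hA (div_nonneg zero_le_one (by linarith))
  have hB0 : 0 ≤ B := by linarith
  have hBp : A ^ (p / (p - 1)) = B ^ p := by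
    rw [hB, ← Real.rpow_mul hA0.le]
    congr 1
    ring
  have hBA : B * A = B ^ p := by
    rw [← hBp, hB, ← Real.rpow_add_one hA0.ne']
    congr 1
    field_simp
    ring
  have hBpq : B ^ p * (a * r ^ q) ≤ B ^ q * (a * r ^ q) :=
    mul_le_mul_of_nonneg_right (Real.rpow_le_rpow_of_exponent_le hB1 hpq) (by positivity)
  rw [hBp, Real.mul_rpow hB0 hr.le, Real.mul_rpow hB0 hr.le]
  calc B * r * (A * t) - (B ^ p * r ^ p + a * (B ^ q * r ^ q))
      = B * A * (r * t) - B ^ p * r ^ p - B ^ q * (a * r ^ q) := by ring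
    _ ≤ B ^ p * (r * t) - B ^ p * r ^ p - B ^ p * (a * r ^ q) := by rw [hBA]; linarith
    _ = B ^ p * (r * t - (r ^ p + a * r ^ q)) := by ring

/-- sub-homogeneity of the convex conjugate of the double-phase function.
For `1 < p ≤ q`, `a₀ ≥ 0`, `H₀ t = t^p + a₀ t^q` and its convex conjugate
`H₀* t = sup_{s > 0} (s·t − H₀ s)`, for every `A ≥ 1` and `t ≥ 0` one has
`H₀*(A·t) ≤ A^{p/(p−1)} · H₀*(t)`. -/
theorem stmt_1 (p q a₀ : ℝ) (hp : 1 < p) (hpq : p ≤ q) (ha : 0 ≤ a₀)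
    (H₀ Hstar : ℝ → ℝ)
    (hH : ∀ t : ℝ, H₀ t = t ^ p + a₀ * t ^ q)
    (hHstar : ∀ t : ℝ, Hstar t = sSup {y : ℝ | ∃ s : ℝ, 0 < s ∧ y = s * t - H₀ s}) :
    ∀ A t : ℝ, 1 ≤ A → 0 ≤ t → Hstar (A * t) ≤ A ^ (p / (p - 1)) * Hstar t := by
  intro A t hA ht
  have hB : 0 < A ^ (1 / (p - 1)) := Real.rpow_pos_of_pos (by linarith) _
  simp only [hHstar, hH]
  refine csSup_le ⟨_, 1, one_pos, rfl⟩ ?_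
  rintro y ⟨s, hs, rfl⟩
  have hr : 0 < s / A ^ (1 / (p - 1)) := div_pos hs hB
  have key := doublePhase_conjugate_term_le (t := t) hp hpq ha hA hr
  rw [mul_div_cancel₀ s hB.ne'] at key
  refine key.trans (mul_le_mul_of_nonneg_left ?_ (Real.rpow_nonneg (by linarith) _))
  exact le_csSup (bddAbove_doublePhase_conjugate hp ha ht) ⟨_, hr, rfl⟩
end

section
/- Let n ≥ 1, α ∈ (0,1], 1 < p ≤ q with q ≤ p + α, σ ≥ 0, M ≥ 0, and let a : ℝⁿ → [0,∞) satisfy |a(x) − a(y)| ≤ M·|x−y|^α for all x, y. Then there exists a constant c ≥ 1, depending only on M, σ, α, p, q, such that for every ball B ⊆ ℝⁿ of radius r ≤ 1, all x, y ∈ B, and every t with 0 ≤ t ≤ 1/r, one has (t^p + a(x)·t^q)^{1+σ} ≤ c · (t^p + a(y)·t^q)^{1+σ}. -/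
/-- At the natural scale `t ≤ 1 / r`, the oscillation factor `d ^ α` of an `α`-Hölder function
over distance `d ≤ 2 * r` absorbs the gap between the powers `t ^ q` and `t ^ p`. -/
theorem rpow_mul_rpow_le_two_mul_rpow {α p q d r t : ℝ} (hα : 0 ≤ α) (hα1 : α ≤ 1)
    (hp : 0 ≤ p) (hpq : p ≤ q) (hqpα : q ≤ p + α) (hd : 0 ≤ d) (hdr : d ≤ 2 * r)
    (hr : 0 < r) (hr1 : r ≤ 1) (ht : 0 ≤ t) (htr : t ≤ 1 / r) :
    d ^ α * t ^ q ≤ 2 * t ^ p := by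
  have hsplit : t ^ q = t ^ p * t ^ (q - p) := by
    rw [← Real.rpow_add_of_nonneg ht hp (sub_nonneg.2 hpq), add_sub_cancel]
  have htwo : (2 : ℝ) ^ α ≤ 2 := by
    simpa using Real.rpow_le_rpow_of_exponent_le one_le_two hα1
  have hdα : d ^ α ≤ 2 * r ^ (q - p) :=
    calc d ^ α ≤ (2 * r) ^ α := Real.rpow_le_rpow hd hdr hα
      _ = 2 ^ α * r ^ α := Real.mul_rpow zero_le_two hr.le
      _ ≤ 2 * r ^ (q - p) := by
        gcongr ?_ * ?_
        exact Real.rpow_le_rpow_of_exponent_ge hr hr1 (by linarith)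
  have hrt : r ^ (q - p) * t ^ (q - p) ≤ 1 := by
    rw [← Real.mul_rpow hr.le ht]
    refine Real.rpow_le_one (by positivity) ?_ (sub_nonneg.2 hpq)
    rw [mul_comm]
    exact (le_div_iff₀ hr).1 htr
  calc d ^ α * t ^ q ≤ 2 * r ^ (q - p) * t ^ q := by gcongr
    _ = 2 * t ^ p * (r ^ (q - p) * t ^ (q - p)) := by rw [hsplit]; ring
    _ ≤ 2 * t ^ p := mul_le_of_le_one_right (by positivity) hrt


/-- display (condsi): pointwise balancing of the double-phase integrand.
If `a : ℝⁿ → [0,∞)` is `α`-Hölder with constant `M`, `1 < p ≤ q ≤ p + α`, `σ ≥ 0`, then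
there is `c ≥ 1` depending only on `M, σ, α, p, q` such that for every ball of radius
`r ≤ 1`, all `x, y` in the ball, and all `0 ≤ t ≤ 1/r`,
`(t^p + a x · t^q)^{1+σ} ≤ c · (t^p + a y · t^q)^{1+σ}`. -/
theorem stmt_2 (α p q σ M : ℝ)
    (hα : 0 < α) (hα1 : α ≤ 1) (hp : 1 < p) (hpq : p ≤ q) (hqpα : q ≤ p + α)
    (hσ : 0 ≤ σ) (hM : 0 ≤ M) :
    ∃ c : ℝ, 1 ≤ c ∧ ∀ (n : ℕ), 1 ≤ n →
      ∀ a : EuclideanSpace ℝ (Fin n) → ℝ, (∀ x, 0 ≤ a x) →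
        (∀ x y, |a x - a y| ≤ M * ‖x - y‖ ^ α) →
        ∀ (z : EuclideanSpace ℝ (Fin n)) (r : ℝ), 0 < r → r ≤ 1 →
          ∀ x ∈ Metric.ball z r, ∀ y ∈ Metric.ball z r, ∀ t : ℝ, 0 ≤ t → t ≤ 1 / r →
            (t ^ p + a x * t ^ q) ^ (1 + σ) ≤ c * (t ^ p + a y * t ^ q) ^ (1 + σ) := by
  refine ⟨(1 + 2 * M) ^ (1 + σ), Real.one_le_rpow (by linarith) (by linarith), ?_⟩
  intro n _ a ha hHolder z r hr hr1 x hx y hy t ht htr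
  have hdist : ‖x - y‖ ≤ 2 * r := by
    rw [← dist_eq_norm]
    linarith [dist_triangle_right x y z, Metric.mem_ball.1 hx, Metric.mem_ball.1 hy]
  have hgap : ‖x - y‖ ^ α * t ^ q ≤ 2 * t ^ p :=
    rpow_mul_rpow_le_two_mul_rpow hα.le hα1 (by linarith) hpq hqpα (norm_nonneg _) hdist
      hr hr1 ht htr
  have hax : a x ≤ a y + M * ‖x - y‖ ^ α := by
    linarith [le_abs_self (a x - a y), hHolder x y]
  have htp : 0 ≤ t ^ p := Real.rpow_nonneg ht p
  have htq : 0 ≤ t ^ q := Real.rpow_nonneg ht q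
  have hax0 := ha x
  have hay0 := ha y
  rw [← Real.mul_rpow (by positivity) (by positivity)]
  refine Real.rpow_le_rpow (by positivity) ?_ (by linarith)
  calc t ^ p + a x * t ^ q ≤ t ^ p + (a y + M * ‖x - y‖ ^ α) * t ^ q := by gcongr
    _ = t ^ p + a y * t ^ q + M * (‖x - y‖ ^ α * t ^ q) := by ring
    _ ≤ t ^ p + a y * t ^ q + M * (2 * t ^ p) := by gcongr
    _ ≤ (1 + 2 * M) * (t ^ p + a y * t ^ q) := by
      have : 0 ≤ M * (a y * t ^ q) := by positivity
      linarith
end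

section
/- Let n ≥ 1, α ∈ (0,1], 1 < p ≤ q with q ≤ p + α, M ≥ 0, and let a : ℝⁿ → [0,∞) satisfy |a(x) − a(y)| ≤ M·|x−y|^α for all x, y. Then there exists a constant c ≥ 1 depending only on p, q, M such that for every R ∈ (0,1], every ball B of radius R in ℝⁿ, every x ∈ B, and every τ with 0 ≤ τ ≤ 2/R, one has τ^p + a(x)·τ^q ≤ c · (τ^p + (inf_{y ∈ B} a(y))·τ^q). -/
/-- On a ball of radius `R`, an `α`-Hölder function exceeds its infimum by at most its Hölder
constant times `(2R)^α`. -/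
theorem le_sInf_image_ball_add {E : Type*} [SeminormedAddCommGroup E] {a : E → ℝ} {M α : ℝ}
    (hM : 0 ≤ M) (hα : 0 ≤ α) (ha : ∀ x y, |a x - a y| ≤ M * ‖x - y‖ ^ α)
    {z x : E} {R : ℝ} (hx : x ∈ Metric.ball z R) :
    a x ≤ sInf (a '' Metric.ball z R) + M * (2 * R) ^ α := by
  rw [← sub_le_iff_le_add]
  refine le_csInf ⟨a x, x, hx, rfl⟩ ?_
  rintro _ ⟨y, hy, rfl⟩
  have hxy : ‖x - y‖ ≤ 2 * R := by
    rw [← dist_eq_norm]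
    linarith [dist_triangle_right x y z, Metric.mem_ball.mp hx, Metric.mem_ball.mp hy]
  have hpow : M * ‖x - y‖ ^ α ≤ M * (2 * R) ^ α :=
    mul_le_mul_of_nonneg_left (Real.rpow_le_rpow (norm_nonneg _) hxy hα) hM
  linarith [le_abs_self (a x - a y), ha x y]

theorem rpow_two_mul_mul_rpow_le {p q α R τ : ℝ} (hp : 0 ≤ p) (hpq : p ≤ q)
    (hα1 : α ≤ 1) (hq : q ≤ p + α) (hR : 0 < R) (hR1 : R ≤ 1) (hτ : 0 ≤ τ) (hτR : τ ≤ 2 / R) :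
    (2 * R) ^ α * τ ^ q ≤ 4 * τ ^ p := by
  have hsplit : τ ^ q = τ ^ (q - p) * τ ^ p := by
    rw [← Real.rpow_add_of_nonneg hτ (sub_nonneg.mpr hpq) hp, sub_add_cancel]
  have hone : 1 ≤ 2 / R := by
    rw [le_div_iff₀ hR]
    linarith
  have hτα : τ ^ (q - p) ≤ (2 / R) ^ α :=
    (Real.rpow_le_rpow hτ hτR (sub_nonneg.mpr hpq)).trans
      (Real.rpow_le_rpow_of_exponent_le hone (by linarith))
  have hfour : (2 * R) ^ α * (2 / R) ^ α ≤ 4 := by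
    rw [← Real.mul_rpow (by positivity) (by positivity),
      show 2 * R * (2 / R) = 4 by field_simp; norm_num]
    calc (4 : ℝ) ^ α ≤ 4 ^ (1 : ℝ) := Real.rpow_le_rpow_of_exponent_le (by norm_num) hα1
      _ = 4 := Real.rpow_one 4
  rw [hsplit, ← mul_assoc]
  exact mul_le_mul_of_nonneg_right
    ((mul_le_mul_of_nonneg_left hτα (by positivity)).trans hfour) (by positivity)

/-- Lemma 3.2: control of `H(x,τ)` by the frozen integrand `H⁻_B(τ)`.
If `a : ℝⁿ → [0,∞)` is `α`-Hölder with constant `M` and `1 < p ≤ q ≤ p + α`, then there is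
`c ≥ 1` depending only on `p, q, M` such that for every ball `B` of radius `R ∈ (0,1]`,
every `x ∈ B` and every `0 ≤ τ ≤ 2/R`,
`τ^p + a x · τ^q ≤ c · (τ^p + (inf_B a) · τ^q)`. -/
theorem stmt_3 (p q M : ℝ) (hp : 1 < p) (hpq : p ≤ q) (hM : 0 ≤ M) :
    ∃ c : ℝ, 1 ≤ c ∧ ∀ (n : ℕ), 1 ≤ n → ∀ α : ℝ, 0 < α → α ≤ 1 → q ≤ p + α →
      ∀ a : EuclideanSpace ℝ (Fin n) → ℝ, (∀ x, 0 ≤ a x) →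
        (∀ x y, |a x - a y| ≤ M * ‖x - y‖ ^ α) →
        ∀ (z : EuclideanSpace ℝ (Fin n)) (R : ℝ), 0 < R → R ≤ 1 →
          ∀ x ∈ Metric.ball z R, ∀ τ : ℝ, 0 ≤ τ → τ ≤ 2 / R →
            τ ^ p + a x * τ ^ q ≤ c * (τ ^ p + sInf (a '' Metric.ball z R) * τ ^ q) := by
  refine ⟨1 + 4 * M, by linarith, ?_⟩
  intro n _ α hα hα1 hq a ha hHol z R hR hR1 x hx τ hτ hτR
  have hosc := mul_le_mul_of_nonneg_right (le_sInf_image_ball_add hM hα.le hHol hx)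
    (Real.rpow_nonneg hτ q)
  have hscale := mul_le_mul_of_nonneg_left
    (rpow_two_mul_mul_rpow_le (by linarith) hpq hα1 hq hR hR1 hτ hτR) hM
  have hinf : 0 ≤ sInf (a '' Metric.ball z R) :=
    Real.sInf_nonneg (by rintro _ ⟨y, _, rfl⟩; exact ha y)
  have hprod : 0 ≤ M * (sInf (a '' Metric.ball z R) * τ ^ q) := by positivity
  linarith
end

section
/- Let n ≥ 1 and let Φ : ℝⁿ × [0,∞) → [0,∞) be such that x ↦ Φ(x,t) is Lebesgue measurable for every t ≥ 0 and t ↦ Φ(x,t) is nondecreasing for a.e. x. Assume there exist β₄ ∈ (0,1] and c_d ≥ 1 such that ess sup_{x ∈ B} Φ(x, β₄·t) ≤ c_d · ess inf_{x ∈ B} Φ(x, t) for every ball B ⊆ ℝⁿ of radius r(B) ≤ 1 and every t with 1 ≤ t ≤ 2/(β₄·r(B)). Then for every set E ⊆ ℝⁿ one has 𝓗⁺_Φ(E) ≤ (c_d / β₄ⁿ) · 𝓗⁻_Φ(E). -/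
open MeasureTheory Metric
open scoped ENNReal NNReal

/-- `h⁺_Φ(B) = |B| · ess sup_{x ∈ B} Φ(x, 1/r(B))` for the ball `B = B(z,r)`
(with values in `ℝ≥0∞`). -/
noncomputable def hPlusE (n : ℕ) (Φ : EuclideanSpace ℝ (Fin n) → ℝ → ℝ)
    (z : EuclideanSpace ℝ (Fin n)) (r : ℝ) : ℝ≥0∞ :=
  volume (ball z r) *
    essSup (fun x => ENNReal.ofReal (Φ x (1 / r))) (volume.restrict (ball z r))

/-- `h⁻_Φ(B) = |B| · ess inf_{x ∈ B} Φ(x, 1/r(B))` for the ball `B = B(z,r)`. -/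
noncomputable def hMinusE (n : ℕ) (Φ : EuclideanSpace ℝ (Fin n) → ℝ → ℝ)
    (z : EuclideanSpace ℝ (Fin n)) (r : ℝ) : ℝ≥0∞ :=
  volume (ball z r) *
    essInf (fun x => ENNReal.ofReal (Φ x (1 / r))) (volume.restrict (ball z r))

/-- A countable collection of balls (given by centers and radii) with positive radii at
most `κ` covering `E`. -/
def IsBallCover (n : ℕ) (κ : ℝ) (E : Set (EuclideanSpace ℝ (Fin n)))
    (c : ℕ → EuclideanSpace ℝ (Fin n) × ℝ) : Prop :=
  (∀ j, 0 < (c j).2 ∧ (c j).2 ≤ κ) ∧ E ⊆ ⋃ j, ball (c j).1 (c j).2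

/-- The approximating set function `𝓗⁺_{Φ,κ}`. -/
noncomputable def HPlusPre (n : ℕ) (Φ : EuclideanSpace ℝ (Fin n) → ℝ → ℝ) (κ : ℝ)
    (E : Set (EuclideanSpace ℝ (Fin n))) : ℝ≥0∞ :=
  ⨅ (c : ℕ → EuclideanSpace ℝ (Fin n) × ℝ) (_ : IsBallCover n κ E c),
    ∑' j, hPlusE n Φ (c j).1 (c j).2

/-- The approximating set function `𝓗⁻_{Φ,κ}`. -/
noncomputable def HMinusPre (n : ℕ) (Φ : EuclideanSpace ℝ (Fin n) → ℝ → ℝ) (κ : ℝ)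
    (E : Set (EuclideanSpace ℝ (Fin n))) : ℝ≥0∞ :=
  ⨅ (c : ℕ → EuclideanSpace ℝ (Fin n) × ℝ) (_ : IsBallCover n κ E c),
    ∑' j, hMinusE n Φ (c j).1 (c j).2

/-- The weighted Hausdorff-type measure `𝓗⁺_Φ = sup_{0 < κ ≤ 1} 𝓗⁺_{Φ,κ}`. -/
noncomputable def HPlusMeasure (n : ℕ) (Φ : EuclideanSpace ℝ (Fin n) → ℝ → ℝ)
    (E : Set (EuclideanSpace ℝ (Fin n))) : ℝ≥0∞ :=
  ⨆ (κ : ℝ) (_ : 0 < κ ∧ κ ≤ 1), HPlusPre n Φ κ E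

/-- The weighted Hausdorff-type measure `𝓗⁻_Φ = sup_{0 < κ ≤ 1} 𝓗⁻_{Φ,κ}`. -/
noncomputable def HMinusMeasure (n : ℕ) (Φ : EuclideanSpace ℝ (Fin n) → ℝ → ℝ)
    (E : Set (EuclideanSpace ℝ (Fin n))) : ℝ≥0∞ :=
  ⨆ (κ : ℝ) (_ : 0 < κ ∧ κ ≤ 1), HMinusPre n Φ κ E

/-- Enlarging the radius of a ball in `ℝⁿ` by the factor `1 / β` multiplies its volume
by `1 / β ^ n`. -/
theorem volume_ball_div (n : ℕ) (z : EuclideanSpace ℝ (Fin n)) (r : ℝ) {β : ℝ} (hβ : 0 < β) :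
    volume (ball z (r / β)) = ENNReal.ofReal (1 / β ^ n) * volume (ball z r) := by
  rw [div_eq_inv_mul, Measure.addHaar_ball_mul_of_pos volume z (inv_pos.2 hβ) r,
    Measure.addHaar_ball_center volume z r, finrank_euclideanSpace_fin, inv_pow, one_div]

/-- If the balancing inequality holds on the ball of radius `r / β` at height `1 / r`, then `h⁺` of
that ball is controlled by `h⁻` of the concentric ball of radius `r`. -/
theorem hPlusE_div_le_hMinusE (n : ℕ) (Φ : EuclideanSpace ℝ (Fin n) → ℝ → ℝ) {β c : ℝ}
    (hβ : 0 < β) (hβ1 : β ≤ 1) (hc : 0 ≤ c) (z : EuclideanSpace ℝ (Fin n)) {r : ℝ} (hr : 0 < r)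
    (h : essSup (fun x => ENNReal.ofReal (Φ x (β * (1 / r)))) (volume.restrict (ball z (r / β))) ≤
      ENNReal.ofReal c *
        essInf (fun x => ENNReal.ofReal (Φ x (1 / r))) (volume.restrict (ball z (r / β)))) :
    hPlusE n Φ z (r / β) ≤ ENNReal.ofReal (c / β ^ n) * hMinusE n Φ z r := by
  have hsub : ball z r ⊆ ball z (r / β) := ball_subset_ball (le_div_self hr.le hβ hβ1)
  have hinf : essInf (fun x => ENNReal.ofReal (Φ x (1 / r))) (volume.restrict (ball z (r / β))) ≤
      essInf (fun x => ENNReal.ofReal (Φ x (1 / r))) (volume.restrict (ball z r)) :=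
    essInf_antitone_measure (Measure.restrict_mono hsub le_rfl).absolutelyContinuous
  have ht : 1 / (r / β) = β * (1 / r) := by rw [one_div_div, mul_one_div]
  unfold hPlusE hMinusE
  rw [ht, volume_ball_div n z r hβ, div_eq_mul_one_div c, ENNReal.ofReal_mul hc]
  refine (mul_le_mul_right (h.trans (mul_le_mul_right hinf _)) _).trans_eq ?_
  ring

/-- Proposition 1.3, inequality (othercontrol). Under the balancing
condition `ess sup_B Φ(·, β₄ t) ≤ c_d · ess inf_B Φ(·, t)` for balls of radius `≤ 1` and
`1 ≤ t ≤ 2/(β₄ r(B))`, one has `𝓗⁺_Φ(E) ≤ (c_d/β₄ⁿ) · 𝓗⁻_Φ(E)` for every `E ⊆ ℝⁿ`. -/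
theorem stmt_4 (n : ℕ) (hn : 1 ≤ n) (Φ : EuclideanSpace ℝ (Fin n) → ℝ → ℝ)
    (hmeas : ∀ t : ℝ, Measurable fun x => Φ x t)
    (hnonneg : ∀ x, ∀ t : ℝ, 0 ≤ t → 0 ≤ Φ x t)
    (hmono : ∀ᵐ x ∂(volume : Measure (EuclideanSpace ℝ (Fin n))),
      ∀ s t : ℝ, 0 ≤ s → s ≤ t → Φ x s ≤ Φ x t)
    (β₄ c_d : ℝ) (hβ : 0 < β₄) (hβ1 : β₄ ≤ 1) (hcd : 1 ≤ c_d)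
    (hbal : ∀ (z : EuclideanSpace ℝ (Fin n)) (r : ℝ), 0 < r → r ≤ 1 →
      ∀ t : ℝ, 1 ≤ t → t ≤ 2 / (β₄ * r) →
        essSup (fun x => ENNReal.ofReal (Φ x (β₄ * t))) (volume.restrict (ball z r)) ≤
          ENNReal.ofReal c_d *
            essInf (fun x => ENNReal.ofReal (Φ x t)) (volume.restrict (ball z r))) :
    ∀ E : Set (EuclideanSpace ℝ (Fin n)),
      HPlusMeasure n Φ E ≤ ENNReal.ofReal (c_d / β₄ ^ n) * HMinusMeasure n Φ E := by
  intro E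
  have hc : 0 ≤ c_d := zero_le_one.trans hcd
  refine iSup₂_le fun κ ⟨hκ, hκ1⟩ => ?_
  have hκβ : 0 < κ * β₄ ∧ κ * β₄ ≤ 1 := ⟨mul_pos hκ hβ, mul_le_one₀ hκ1 hβ.le hβ1⟩
  refine le_trans ?_ (mul_le_mul_right (le_iSup₂ (f := fun (κ : ℝ) (_ : 0 < κ ∧ κ ≤ 1) =>
    HMinusPre n Φ κ E) (κ * β₄) hκβ) _)
  have hpos : ENNReal.ofReal (c_d / β₄ ^ n) ≠ 0 :=
    (ENNReal.ofReal_pos.2 (div_pos (zero_lt_one.trans_le hcd) (pow_pos hβ n))).ne'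
  unfold HMinusPre
  simp only [ENNReal.mul_iInf_of_ne hpos ENNReal.ofReal_ne_top]
  refine le_iInf₂ fun c ⟨hrad, hcov⟩ => ?_
  have hle : ∀ j, (c j).2 / β₄ ≤ κ := fun j => (div_le_iff₀ hβ).2 (hrad j).2
  have hcover : IsBallCover n κ E fun j => ((c j).1, (c j).2 / β₄) :=
    ⟨fun j => ⟨div_pos (hrad j).1 hβ, hle j⟩, hcov.trans <| Set.iUnion_mono fun j =>
      ball_subset_ball (le_div_self (hrad j).1.le hβ hβ1)⟩
  refine (iInf₂_le _ hcover).trans ?_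
  rw [← ENNReal.tsum_mul_left]
  refine ENNReal.tsum_le_tsum fun j => ?_
  have hr := (hrad j).1
  refine hPlusE_div_le_hMinusE n Φ hβ hβ1 hc _ hr
    (hbal _ _ (div_pos hr hβ) ((hle j).trans hκ1) _ ?_ ?_)
  · exact (one_le_div hr).2 ((hrad j).2.trans hκβ.2)
  · rw [mul_div_cancel₀ _ hβ.ne']
    gcongr
    norm_num
end

section
/- Let n ≥ 1, α ∈ (0,1], 1 < p ≤ q with q ≤ p + α, δ ≥ 0, M ≥ 0, and let a : ℝⁿ → [0,∞) satisfy |a(x) − a(y)| ≤ M·|x−y|^α for all x,y. Define Φ_δ(x,t) = (t^p + a(x)·t^q)^{1+δ}. Then there exists a constant c ≥ 1, depending only on M, δ, α, p, q, such that for every set E ⊆ ℝⁿ one has 𝓗⁻_{Φ_δ}(E) ≤ 𝓗_{Φ_δ}(E) ≤ 𝓗⁺_{Φ_δ}(E) ≤ c · 𝓗⁻_{Φ_δ}(E). -/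
open MeasureTheory Metric
open scoped ENNReal NNReal

/-- `h_Φ(B) = ∫_B Φ(x, 1/r(B)) dx` (Lebesgue integral) for the ball `B = B(z,r)`. -/
noncomputable def hIntE (n : ℕ) (Φ : EuclideanSpace ℝ (Fin n) → ℝ → ℝ)
    (z : EuclideanSpace ℝ (Fin n)) (r : ℝ) : ℝ≥0∞ :=
  ∫⁻ x in ball z r, ENNReal.ofReal (Φ x (1 / r))

/-- The approximating set function `𝓗_{Φ,κ}`. -/
noncomputable def HIntPre (n : ℕ) (Φ : EuclideanSpace ℝ (Fin n) → ℝ → ℝ) (κ : ℝ)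
    (E : Set (EuclideanSpace ℝ (Fin n))) : ℝ≥0∞ :=
  ⨅ (c : ℕ → EuclideanSpace ℝ (Fin n) × ℝ) (_ : IsBallCover n κ E c),
    ∑' j, hIntE n Φ (c j).1 (c j).2

/-- `𝓗_Φ = sup_{0 < κ ≤ 1} 𝓗_{Φ,κ}`. -/
noncomputable def HIntMeasure (n : ℕ) (Φ : EuclideanSpace ℝ (Fin n) → ℝ → ℝ)
    (E : Set (EuclideanSpace ℝ (Fin n))) : ℝ≥0∞ :=
  ⨆ (κ : ℝ) (_ : 0 < κ ∧ κ ≤ 1), HIntPre n Φ κ E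

/-- A double-phase integrand with `α`-Hölder coefficient oscillates at scale `r ≤ 1` by at most
a multiplicative constant on each ball of radius `r`. -/
theorem doublePhase_le_mul {X : Type*} [SeminormedAddCommGroup X] {α p q δ M : ℝ}
    (hα : 0 < α) (hqpα : q ≤ p + α) (hδ : 0 ≤ δ) (hM : 0 ≤ M) {a : X → ℝ}
    (ha : ∀ x, 0 ≤ a x) (hH : ∀ x y, |a x - a y| ≤ M * ‖x - y‖ ^ α)
    {z x y : X} {r : ℝ} (hr : 0 < r) (hr1 : r ≤ 1) (hx : x ∈ ball z r) (hy : y ∈ ball z r) :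
    ((1 / r) ^ p + a x * (1 / r) ^ q) ^ (1 + δ) ≤
      (1 + M * 2 ^ α) ^ (1 + δ) * ((1 / r) ^ p + a y * (1 / r) ^ q) ^ (1 + δ) := by
  have hxy : ‖x - y‖ ≤ 2 * r := by
    rw [← dist_eq_norm]
    linarith [dist_triangle_right x y z, mem_ball.mp hx, mem_ball.mp hy]
  have hay := ha y
  have hK : 0 ≤ M * 2 ^ α := by positivity
  have hp0 : 0 ≤ (1 / r) ^ p := by positivity
  have hq0 : 0 ≤ (1 / r) ^ q := by positivity
  have hosc : a x ≤ a y + M * 2 ^ α * r ^ α := by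
    have h : ‖x - y‖ ^ α ≤ 2 ^ α * r ^ α := by
      rw [← Real.mul_rpow zero_le_two hr.le]
      exact Real.rpow_le_rpow (norm_nonneg _) hxy hα.le
    nlinarith [le_abs_self (a x - a y), hH x y, mul_le_mul_of_nonneg_left h hM]
  have hscale : r ^ α * (1 / r) ^ q ≤ (1 / r) ^ p := by
    rw [one_div, Real.inv_rpow hr.le, Real.inv_rpow hr.le, ← Real.rpow_neg hr.le,
      ← Real.rpow_neg hr.le, ← Real.rpow_add hr]
    exact Real.rpow_le_rpow_of_exponent_ge hr hr1 (by linarith)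
  rw [← Real.mul_rpow (by positivity) (by positivity)]
  refine Real.rpow_le_rpow (add_nonneg hp0 (mul_nonneg (ha x) hq0)) ?_ (by linarith)
  nlinarith [mul_le_mul_of_nonneg_right hosc hq0, mul_le_mul_of_nonneg_left hscale hK,
    mul_nonneg hK (mul_nonneg hay hq0)]

theorem hMinusE_le_hIntE (n : ℕ) (Φ : EuclideanSpace ℝ (Fin n) → ℝ → ℝ)
    (z : EuclideanSpace ℝ (Fin n)) (r : ℝ) : hMinusE n Φ z r ≤ hIntE n Φ z r := by
  unfold hMinusE hIntE
  rw [mul_comm, ← setLIntegral_const]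
  exact lintegral_mono_ae ae_essInf_le

theorem hIntE_le_hPlusE (n : ℕ) (Φ : EuclideanSpace ℝ (Fin n) → ℝ → ℝ)
    (z : EuclideanSpace ℝ (Fin n)) (r : ℝ) : hIntE n Φ z r ≤ hPlusE n Φ z r := by
  unfold hPlusE hIntE
  rw [mul_comm, ← setLIntegral_const]
  exact lintegral_mono_ae (ENNReal.ae_le_essSup _)

/-- If `Φ(·, 1/r)` oscillates by at most the factor `C` on a ball, then `h⁺ ≤ C · h⁻` there. -/
theorem hPlusE_le_mul_hMinusE {n : ℕ} {Φ : EuclideanSpace ℝ (Fin n) → ℝ → ℝ}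
    {z : EuclideanSpace ℝ (Fin n)} {r C : ℝ} (hC : 0 < C)
    (h : ∀ x ∈ ball z r, ∀ y ∈ ball z r, Φ x (1 / r) ≤ C * Φ y (1 / r)) :
    hPlusE n Φ z r ≤ ENNReal.ofReal C * hMinusE n Φ z r := by
  unfold hPlusE hMinusE
  rw [mul_left_comm]
  gcongr
  have hC0 : ENNReal.ofReal C ≠ 0 := by simpa using hC
  rw [mul_comm, ← ENNReal.div_le_iff hC0 ENNReal.ofReal_ne_top]
  refine le_essInf_of_ae_le _ ?_
  filter_upwards [ae_restrict_mem measurableSet_ball] with y hy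
  rw [ENNReal.div_le_iff hC0 ENNReal.ofReal_ne_top, mul_comm]
  refine essSup_le_of_ae_le _ ?_
  filter_upwards [ae_restrict_mem measurableSet_ball] with x hx
  rw [← ENNReal.ofReal_mul hC.le]
  exact ENNReal.ofReal_le_ofReal (h x hx y hy)

/-- Proposition 1.3, inequality (othercontrol2). For the double-phase
integrand `Φ_δ(x,t) = (t^p + a(x)t^q)^{1+δ}` with `a` being `α`-Hölder, `q ≤ p + α`,
the three Hausdorff-type measures `𝓗⁻, 𝓗, 𝓗⁺` generated by `Φ_δ` are comparable:
`𝓗⁻ ≤ 𝓗 ≤ 𝓗⁺ ≤ c·𝓗⁻` for some `c ≥ 1` depending only on `M, δ, α, p, q`. -/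
theorem stmt_5 (α p q δ M : ℝ)
    (hα : 0 < α) (hα1 : α ≤ 1) (hp : 1 < p) (hpq : p ≤ q) (hqpα : q ≤ p + α)
    (hδ : 0 ≤ δ) (hM : 0 ≤ M) :
    ∃ c : ℝ, 1 ≤ c ∧ ∀ (n : ℕ), 1 ≤ n →
      ∀ a : EuclideanSpace ℝ (Fin n) → ℝ, (∀ x, 0 ≤ a x) →
        (∀ x y, |a x - a y| ≤ M * ‖x - y‖ ^ α) →
        ∀ Φ : EuclideanSpace ℝ (Fin n) → ℝ → ℝ,
          (∀ x t, Φ x t = (t ^ p + a x * t ^ q) ^ (1 + δ)) →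
          ∀ E : Set (EuclideanSpace ℝ (Fin n)),
            HMinusMeasure n Φ E ≤ HIntMeasure n Φ E ∧
            HIntMeasure n Φ E ≤ HPlusMeasure n Φ E ∧
            HPlusMeasure n Φ E ≤ ENNReal.ofReal c * HMinusMeasure n Φ E := by
  have hbase : 1 ≤ 1 + M * 2 ^ α := le_add_of_nonneg_right (by positivity)
  have hc : 1 ≤ (1 + M * 2 ^ α) ^ (1 + δ) := Real.one_le_rpow hbase (by linarith)
  have hc0 : 0 < (1 + M * 2 ^ α) ^ (1 + δ) := zero_lt_one.trans_le hc
  refine ⟨(1 + M * 2 ^ α) ^ (1 + δ), hc, fun n _ a ha hH Φ hΦ E => ⟨?_, ?_, ?_⟩⟩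
  · exact iSup₂_mono fun κ _ => iInf₂_mono fun c _ =>
      ENNReal.tsum_le_tsum fun j => hMinusE_le_hIntE n Φ _ _
  · exact iSup₂_mono fun κ _ => iInf₂_mono fun c _ =>
      ENNReal.tsum_le_tsum fun j => hIntE_le_hPlusE n Φ _ _
  · refine iSup₂_le fun κ hκ => ?_
    refine le_trans ?_ (mul_le_mul_right
      (le_iSup₂ (f := fun (κ : ℝ) (_ : 0 < κ ∧ κ ≤ 1) => HMinusPre n Φ κ E) κ hκ) _)
    refine (ENNReal.div_le_iff' (by simpa using hc0) ENNReal.ofReal_ne_top).mp ?_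
    refine le_iInf₂ fun c hcov => ENNReal.div_le_of_le_mul' ?_
    rw [← ENNReal.tsum_mul_left]
    refine (iInf₂_le c hcov).trans (ENNReal.tsum_le_tsum fun j => ?_)
    refine hPlusE_le_mul_hMinusE hc0 fun x hx y hy => ?_
    rw [hΦ, hΦ]
    exact doublePhase_le_mul hα hqpα hδ hM ha hH (hcov.1 j).1 ((hcov.1 j).2.trans hκ.2) hx hy
end

section
/- Let Ω ⊆ ℝⁿ be open and let Φ : Ω × [0,∞) → [0,∞) be such that x ↦ Φ(x,t) is measurable for every t ≥ 0 and t ↦ Φ(x,t) is nondecreasing for a.e. x. Assume: (a) there exist 1 < p < q and c_g ≥ 1 such that Φ(x,s)/s^p ≤ c_g·Φ(x,t)/t^p and Φ(x,t)/t^q ≤ c_g·Φ(x,s)/s^q whenever 0 < s ≤ t, for a.e. x ∈ Ω; (b) there exist β₄ ∈ (0,1] and c_d ≥ 1 such that ess sup_{x∈B} Φ(x, β₄ t) ≤ c_d · ess inf_{x∈B} Φ(x,t) for every ball B ⊆ Ω of radius r(B) ≤ 1 and every t with 1 ≤ t ≤ 2/(β₄·r(B)). Then for every x₀ and every r ∈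 (0, 1/2] with the ball B(x₀, 2r) ⊆ Ω, one has ∫_{B(x₀,2r)} Φ(x, 1/r) dx ≤ (2ⁿ · c_g · c_d / β₄^q) · ∫_{B(x₀,r)} Φ(x, 1/r) dx. -/
open MeasureTheory Metric
open scoped ENNReal NNReal

/-- key doubling estimate in the proof of Theorem 1.4. Under the
growth condition (0777-2) and the balancing condition (controllo), for every ball
`B(x₀, 2r) ⊆ Ω` with `0 < r ≤ 1/2` one has
`∫_{B(x₀,2r)} Φ(x,1/r) dx ≤ (2ⁿ c_g c_d / β₄^q) ∫_{B(x₀,r)} Φ(x,1/r) dx`. -/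
theorem stmt_7 (n : ℕ) (Ω : Set (EuclideanSpace ℝ (Fin n))) (hΩ : IsOpen Ω)
    (Φ : EuclideanSpace ℝ (Fin n) → ℝ → ℝ)
    (hmeas : ∀ t : ℝ, Measurable fun x => Φ x t)
    (hnonneg : ∀ x ∈ Ω, ∀ t : ℝ, 0 ≤ t → 0 ≤ Φ x t)
    (hmono : ∀ᵐ x ∂(volume : Measure (EuclideanSpace ℝ (Fin n))), x ∈ Ω →
      ∀ s t : ℝ, 0 ≤ s → s ≤ t → Φ x s ≤ Φ x t)
    (p q c_g : ℝ) (hp : 1 < p) (hpq : p < q) (hcg : 1 ≤ c_g)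
    (hgrowth : ∀ᵐ x ∂(volume : Measure (EuclideanSpace ℝ (Fin n))), x ∈ Ω →
      ∀ s t : ℝ, 0 < s → s ≤ t →
        Φ x s / s ^ p ≤ c_g * (Φ x t / t ^ p) ∧ Φ x t / t ^ q ≤ c_g * (Φ x s / s ^ q))
    (β₄ c_d : ℝ) (hβ : 0 < β₄) (hβ1 : β₄ ≤ 1) (hcd : 1 ≤ c_d)
    (hbal : ∀ (z : EuclideanSpace ℝ (Fin n)) (r : ℝ), 0 < r → r ≤ 1 → ball z r ⊆ Ω →
      ∀ t : ℝ, 1 ≤ t → t ≤ 2 / (β₄ * r) →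
        essSup (fun x => ENNReal.ofReal (Φ x (β₄ * t))) (volume.restrict (ball z r)) ≤
          ENNReal.ofReal c_d *
            essInf (fun x => ENNReal.ofReal (Φ x t)) (volume.restrict (ball z r))) :
    ∀ (x₀ : EuclideanSpace ℝ (Fin n)) (r : ℝ), 0 < r → r ≤ 1 / 2 →
      ball x₀ (2 * r) ⊆ Ω →
      ∫⁻ x in ball x₀ (2 * r), ENNReal.ofReal (Φ x (1 / r)) ≤
        ENNReal.ofReal (2 ^ n * c_g * c_d / β₄ ^ q) *
          ∫⁻ x in ball x₀ r, ENNReal.ofReal (Φ x (1 / r)) := by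
  intro x₀ r hr hr2 hB
  set B := ball x₀ (2 * r) with hBdef
  set K : ℝ := c_g / β₄ ^ q with hK
  have hβq : 0 < β₄ ^ q := Real.rpow_pos_of_pos hβ q
  have hK0 : 0 ≤ K := div_nonneg (by linarith) hβq.le
  set S := essSup (fun x => ENNReal.ofReal (Φ x (β₄ * (1 / r)))) (volume.restrict B) with hS
  set I := essInf (fun x => ENNReal.ofReal (Φ x (1 / r))) (volume.restrict B) with hI
  have hSI : S ≤ ENNReal.ofReal c_d * I := by
    refine hbal x₀ (2 * r) (by linarith) (by linarith) hB (1 / r) ?_ ?_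
    · rw [le_div_iff₀ hr]; linarith
    · rw [div_le_div_iff₀ hr (by positivity)]
      nlinarith
  have hupper : ∀ᵐ x ∂volume.restrict B,
      ENNReal.ofReal (Φ x (1 / r)) ≤ ENNReal.ofReal K * S := by
    filter_upwards [ae_restrict_of_ae hgrowth, ae_restrict_mem measurableSet_ball,
      ENNReal.ae_le_essSup (μ := volume.restrict B)
        (fun x => ENNReal.ofReal (Φ x (β₄ * (1 / r))))] with x hx hxB hxS
    have ht : 0 < 1 / r := by positivity
    have h := (hx (hB hxB) (β₄ * (1 / r)) (1 / r) (by positivity)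
      (mul_le_of_le_one_left ht.le hβ1)).2
    have htq : 0 < (1 / r) ^ q := Real.rpow_pos_of_pos ht q
    rw [Real.mul_rpow hβ.le ht.le, div_le_iff₀ htq] at h
    have hreal : Φ x (1 / r) ≤ K * Φ x (β₄ * (1 / r)) := by
      refine h.trans_eq ?_
      rw [hK]
      field_simp
    calc ENNReal.ofReal (Φ x (1 / r))
        ≤ ENNReal.ofReal (K * Φ x (β₄ * (1 / r))) := ENNReal.ofReal_le_ofReal hreal
      _ = ENNReal.ofReal K * ENNReal.ofReal (Φ x (β₄ * (1 / r))) := ENNReal.ofReal_mul hK0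
      _ ≤ ENNReal.ofReal K * S := by gcongr
  have hlower : ∀ᵐ x ∂volume.restrict (ball x₀ r), I ≤ ENNReal.ofReal (Φ x (1 / r)) :=
    ae_restrict_of_ae_restrict_of_subset (ball_subset_ball (by linarith))
      (ae_essInf_le (μ := volume.restrict B) (f := fun x => ENNReal.ofReal (Φ x (1 / r))))
  have hvol : volume B = ENNReal.ofReal (2 ^ n) * volume (ball x₀ r) := by
    rw [hBdef, Measure.addHaar_ball_mul_of_pos volume x₀ two_pos r,
      finrank_euclideanSpace_fin, Measure.addHaar_ball_center volume x₀ r]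
  have hconst : ENNReal.ofReal (2 ^ n * c_g * c_d / β₄ ^ q) =
      ENNReal.ofReal K * ENNReal.ofReal c_d * ENNReal.ofReal (2 ^ n) := by
    rw [← ENNReal.ofReal_mul hK0, ← ENNReal.ofReal_mul (mul_nonneg hK0 (by linarith)), hK]
    congr 1
    ring
  calc ∫⁻ x in B, ENNReal.ofReal (Φ x (1 / r))
      ≤ ∫⁻ _ in B, ENNReal.ofReal K * S := lintegral_mono_ae hupper
    _ = ENNReal.ofReal K * S * volume B := setLIntegral_const _ _
    _ ≤ ENNReal.ofReal K * (ENNReal.ofReal c_d * I) *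
          (ENNReal.ofReal (2 ^ n) * volume (ball x₀ r)) := by rw [hvol]; gcongr
    _ = ENNReal.ofReal (2 ^ n * c_g * c_d / β₄ ^ q) * ∫⁻ _ in ball x₀ r, I := by
        rw [setLIntegral_const, hconst]; ring
    _ ≤ _ := mul_le_mul_right (lintegral_mono_ae hlower) _
end

section
/- Let Ω ⊆ ℝⁿ be a bounded open set and let Φ : Ω × [0,∞) → [0,∞) be a Carathéodory function (measurable in x for each t; continuous and nondecreasing in t for a.e. x) with Φ(x,0) = 0. Assume: (a) there exist 1 < p < q and c_g ≥ 1 such that Φ(x,s)/s^p ≤ c_g·Φ(x,t)/t^p and Φ(x,t)/t^q ≤ c_g·Φ(x,s)/s^q whenever 0 < s ≤ t, for a.e. x ∈ Ω; (b) there exist β₄ ∈ (0,1] and c_d ≥ 1 such that ess sup_{x∈B} Φ(x, β₄ t) ≤ c_d · ess inf_{x∈B} Φ(x,t) for every ball B ⊆ Ω of radius r(B) ≤ 1 and every t with 1 ≤ t ≤ 2/(β₄·r(B)). Let E ⊆ Ω be compact with 𝓗_Φ(E) < ∞. Then for every ε > 0 there exists a Lipschitz function f : ℝⁿ → [0,1]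 with compact support contained in Ω, such that f = 1 on an open neighborhood of E and ∫_Ω Φ(x, ‖Df(x)‖) dx < ε, where Df denotes the Fréchet derivative of f (which exists almost everywhere by Rademacher's theorem, with Df set equal to 0 at points of non-differentiability). -/
open MeasureTheory Metric
open scoped ENNReal NNReal

/-- A countable collection of balls contained in `Ω` with radii at most `κ`
covering `E`. -/
def IsBallCoverIn (n : ℕ) (Ω : Set (EuclideanSpace ℝ (Fin n))) (κ : ℝ)
    (E : Set (EuclideanSpace ℝ (Fin n)))
    (c : ℕ → EuclideanSpace ℝ (Fin n) × ℝ) : Prop :=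
  (∀ j, (c j).2 ≤ κ ∧ ball (c j).1 (c j).2 ⊆ Ω) ∧ E ⊆ ⋃ j, ball (c j).1 (c j).2

/-- The approximating set function `𝓗_{Φ,κ}` (relative to `Ω`). -/
noncomputable def HIntPreIn (n : ℕ) (Ω : Set (EuclideanSpace ℝ (Fin n)))
    (Φ : EuclideanSpace ℝ (Fin n) → ℝ → ℝ) (κ : ℝ)
    (E : Set (EuclideanSpace ℝ (Fin n))) : ℝ≥0∞ :=
  ⨅ (c : ℕ → EuclideanSpace ℝ (Fin n) × ℝ) (_ : IsBallCoverIn n Ω κ E c),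
    ∑' j, hIntE n Φ (c j).1 (c j).2

/-- `𝓗_Φ = sup_{0 < κ ≤ 1} 𝓗_{Φ,κ}` (relative to `Ω`). -/
noncomputable def HIntMeasureIn (n : ℕ) (Ω : Set (EuclideanSpace ℝ (Fin n)))
    (Φ : EuclideanSpace ℝ (Fin n) → ℝ → ℝ)
    (E : Set (EuclideanSpace ℝ (Fin n))) : ℝ≥0∞ :=
  ⨆ (κ : ℝ) (_ : 0 < κ ∧ κ ≤ 1), HIntPreIn n Ω Φ κ E

open Filter Topology

section Cutoff

variable {X : Type*} [PseudoMetricSpace X]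

/-- The cutoff function equal to `1` on `B(z,r)` and to `0` outside `B(z,2r)`. -/
noncomputable def ballCutoff (z : X) (r : ℝ) (x : X) : ℝ :=
  max 0 (min 1 (2 - dist x z / r))

lemma ballCutoff_mem_Icc (z : X) (r : ℝ) (x : X) : ballCutoff z r x ∈ Set.Icc (0 : ℝ) 1 :=
  ⟨le_max_left _ _, max_le zero_le_one (min_le_left _ _)⟩

lemma ballCutoff_eq_one {z : X} {r : ℝ} (hr : 0 < r) {x : X} (hx : x ∈ ball z r) :
    ballCutoff z r x = 1 := by
  have : dist x z / r ≤ 1 := (div_le_one hr).2 (mem_ball.1 hx).le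
  rw [ballCutoff, min_eq_left (by linarith), max_eq_right zero_le_one]

lemma ballCutoff_eq_zero {z : X} {r : ℝ} (hr : 0 < r) {x : X} (hx : x ∉ ball z (2 * r)) :
    ballCutoff z r x = 0 := by
  have : 2 ≤ dist x z / r := (le_div_iff₀ hr).2 (not_lt.1 hx)
  exact max_eq_left ((min_le_right _ _).trans (by linarith))

lemma lipschitzWith_ballCutoff (z : X) {r : ℝ} (hr : 0 < r) :
    LipschitzWith (Real.toNNReal (1 / r)) (ballCutoff z r) := by
  have h : LipschitzWith (Real.toNNReal (1 / r)) fun x : X => 2 - dist x z / r := by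
    refine LipschitzWith.of_dist_le_mul fun x y => ?_
    rw [Real.coe_toNNReal _ (by positivity), Real.dist_eq,
      show 2 - dist x z / r - (2 - dist y z / r) = 1 / r * (dist y z - dist x z) by ring,
      abs_mul, abs_of_pos (by positivity : 0 < 1 / r)]
    gcongr
    rw [dist_comm x y]
    exact abs_dist_sub_le y x z
  exact (h.const_min 1).const_max 0

lemma tsupport_ballCutoff_subset (z : X) {r : ℝ} (hr : 0 < r) :
    tsupport (ballCutoff z r) ⊆ closedBall z (2 * r) :=
  closure_minimal
    (fun _ hx => ball_subset_closedBall (not_imp_comm.1 (ballCutoff_eq_zero hr) hx))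
    isClosed_closedBall

end Cutoff

/-- A Lipschitz cutoff for a finite union of balls whose local Lipschitz constant at each point
is controlled by the inverse radius of one of the doubled balls containing that point. -/
lemma exists_cutoff_biUnion_ball {X : Type*} [PseudoMetricSpace X] {ι : Type*} (s : Finset ι)
    (z : ι → X) (r : ι → ℝ) (hr : ∀ j ∈ s, 0 < r j) :
    ∃ f : X → ℝ, (∃ K, LipschitzWith K f) ∧ (∀ x, f x ∈ Set.Icc (0 : ℝ) 1) ∧
      tsupport f ⊆ ⋃ j ∈ s, closedBall (z j) (2 * r j) ∧
      (∀ j ∈ s, ∀ x ∈ ball (z j) (r j), f x = 1) ∧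
      ∀ x, ∃ C : ℝ, (C = 0 ∨ ∃ j ∈ s, x ∈ closedBall (z j) (2 * r j) ∧ C = 1 / r j) ∧
        ∀ᶠ y in 𝓝 x, |f y - f x| ≤ C * dist y x := by
  classical
  induction s using Finset.induction_on with
  | empty =>
    refine ⟨fun _ => 0, ⟨0, LipschitzWith.const 0⟩, by simp, ?_, by simp,
      fun x => ⟨0, .inl rfl, by simp⟩⟩
    simp [tsupport, Function.support]
  | insert i s _ ih =>
    obtain ⟨f, ⟨K, hK⟩, hf01, hsupp, hone, hloc⟩ := ih fun j hj => hr j (Finset.mem_insert_of_mem hj)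
    have hri : 0 < r i := hr i (Finset.mem_insert_self i s)
    set g := ballCutoff (z i) (r i)
    have hg01 : ∀ x, g x ∈ Set.Icc (0 : ℝ) 1 := ballCutoff_mem_Icc (z i) (r i)
    have hgL : LipschitzWith _ g := lipschitzWith_ballCutoff (z i) hri
    have hgsupp : tsupport g ⊆ closedBall (z i) (2 * r i) := tsupport_ballCutoff_subset (z i) hri
    refine ⟨fun x => max (g x) (f x), ⟨_, hgL.max hK⟩,
      fun x => ⟨(hf01 x).1.trans (le_max_right _ _), max_le (hg01 x).2 (hf01 x).2⟩, ?_, ?_, ?_⟩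
    · rw [Finset.set_biUnion_insert]
      refine (closure_minimal (fun x hx => ?_)
        ((isClosed_tsupport g).union (isClosed_tsupport f))).trans
        (Set.union_subset_union hgsupp hsupp)
      by_contra hcon
      rw [Set.mem_union, not_or] at hcon
      simp [image_eq_zero_of_notMem_tsupport hcon.1,
        image_eq_zero_of_notMem_tsupport hcon.2] at hx
    · intro j hj x hx
      rcases Finset.mem_insert.1 hj with rfl | hj
      · change max (g x) (f x) = 1
        rw [show g x = 1 from ballCutoff_eq_one hri hx]
        exact max_eq_left (hf01 x).2
      · change max (g x) (f x) = 1
        rw [hone j hj x hx]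
        exact max_eq_right (hg01 x).2
    · intro x
      obtain ⟨C, hC, hCx⟩ := hloc x
      have hgx : ∃ D : ℝ, (D = 0 ∨ x ∈ closedBall (z i) (2 * r i) ∧ D = 1 / r i) ∧
          ∀ᶠ y in 𝓝 x, |g y - g x| ≤ D * dist y x := by
        by_cases hx : x ∈ closedBall (z i) (2 * r i)
        · refine ⟨1 / r i, .inr ⟨hx, rfl⟩, Eventually.of_forall fun y => ?_⟩
          have := hgL.dist_le_mul y x
          rwa [Real.coe_toNNReal _ (by positivity), Real.dist_eq] at this
        · refine ⟨0, .inl rfl, ?_⟩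
          have hx' : x ∉ tsupport g := fun h => hx (hgsupp h)
          filter_upwards [notMem_tsupport_iff_eventuallyEq.1 hx'] with y hy
          simp [hy, image_eq_zero_of_notMem_tsupport hx']
      obtain ⟨D, hD, hDx⟩ := hgx
      refine ⟨max D C, ?_, ?_⟩
      · rcases max_choice D C with h | h
        · rw [h]
          rcases hD with hD | ⟨hx, hD⟩
          · exact .inl hD
          · exact .inr ⟨i, Finset.mem_insert_self i s, hx, hD⟩
        · rw [h]
          rcases hC with hC | ⟨j, hj, hx⟩
          · exact .inl hC
          · exact .inr ⟨j, Finset.mem_insert_of_mem hj, hx⟩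
      · filter_upwards [hCx, hDx] with y hy hy'
        refine (abs_max_sub_max_le_max _ _ _ _).trans (max_le (hy'.trans ?_) (hy.trans ?_))
        · exact mul_le_mul_of_nonneg_right (le_max_left _ _) dist_nonneg
        · exact mul_le_mul_of_nonneg_right (le_max_right _ _) dist_nonneg

/-- Doubling: the energy of the cutoff of a ball is controlled by `h_Φ` of that ball. -/
lemma lintegral_closedBall_two_mul_le {n : ℕ} {Φ : EuclideanSpace ℝ (Fin n) → ℝ → ℝ}
    {q c_g β c_d : ℝ} (hcg : 0 ≤ c_g) (hβ : 0 < β) (hβ1 : β ≤ 1)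
    {z : EuclideanSpace ℝ (Fin n)} {r : ℝ} (hr : 0 < r)
    (hgrowth : ∀ᵐ x ∂(volume : Measure (EuclideanSpace ℝ (Fin n))), x ∈ ball z r →
      ∀ s t : ℝ, 0 < s → s ≤ t → Φ x t / t ^ q ≤ c_g * (Φ x s / s ^ q))
    (hbal : essSup (fun x => ENNReal.ofReal (Φ x (β * (1 / (β * r)))))
        (volume.restrict (ball z (2 * r))) ≤
      ENNReal.ofReal c_d * essInf (fun x => ENNReal.ofReal (Φ x (1 / (β * r))))
        (volume.restrict (ball z (2 * r)))) :
    ∫⁻ x in closedBall z (2 * r), ENNReal.ofReal (Φ x (1 / r)) ≤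
      ENNReal.ofReal (2 ^ n * c_d * (c_g * (1 / β) ^ q)) * hIntE n Φ z r := by
  have hβr : β * (1 / (β * r)) = 1 / r := by field_simp
  rw [hβr] at hbal
  set S := essSup (fun x => ENNReal.ofReal (Φ x (1 / r))) (volume.restrict (ball z (2 * r)))
  set I := essInf (fun x => ENNReal.ofReal (Φ x (1 / (β * r)))) (volume.restrict (ball z (2 * r)))
  have hvol : volume (ball z (2 * r)) = ENNReal.ofReal (2 ^ n) * volume (ball z r) := by
    rw [Measure.addHaar_ball_mul_of_pos _ _ two_pos, finrank_euclideanSpace_fin,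
      ← Measure.addHaar_ball_center volume z r]
  have hae : (closedBall z (2 * r) : Set (EuclideanSpace ℝ (Fin n))) =ᵐ[volume] ball z (2 * r) := by
    rw [← ball_union_sphere]
    exact union_ae_eq_left_of_ae_eq_empty
      (ae_eq_empty.2 (Measure.addHaar_sphere_of_ne_zero _ _ (by positivity)))
  have hupper : ∫⁻ x in ball z (2 * r), ENNReal.ofReal (Φ x (1 / r)) ≤
      S * volume (ball z (2 * r)) :=
    (lintegral_mono_ae (ENNReal.ae_le_essSup _)).trans_eq (by simp [S])
  have hsub : ball z r ⊆ ball z (2 * r) := ball_subset_ball (by linarith)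
  have hlower : I * volume (ball z r) ≤ ENNReal.ofReal (c_g * (1 / β) ^ q) * hIntE n Φ z r := by
    rw [hIntE, ← lintegral_const_mul' _ _ ENNReal.ofReal_ne_top]
    have h1 : ∀ᵐ x ∂volume.restrict (ball z r), I ≤ ENNReal.ofReal (Φ x (1 / (β * r))) :=
      ae_mono (Measure.restrict_mono hsub le_rfl) ae_essInf_le
    refine (Eq.le (by simp)).trans (lintegral_mono_ae (f := fun _ => I) ?_)
    filter_upwards [h1, ae_restrict_of_ae hgrowth, ae_restrict_mem measurableSet_ball]
      with x hx hg hxr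
    refine hx.trans ?_
    rw [← ENNReal.ofReal_mul (by positivity)]
    refine ENNReal.ofReal_le_ofReal ?_
    have hst : 1 / r ≤ 1 / (β * r) :=
      one_div_le_one_div_of_le (by positivity) (mul_le_of_le_one_left hr.le hβ1)
    have h2 := hg hxr (1 / r) (1 / (β * r)) (by positivity) hst
    rw [div_le_iff₀ (by positivity)] at h2
    refine h2.trans_eq ?_
    rw [show 1 / (β * r) = 1 / β * (1 / r) by field_simp,
      Real.mul_rpow (by positivity) (by positivity)]
    have : (1 / r) ^ q ≠ 0 := by positivity
    field_simp
  have hcc : ENNReal.ofReal (2 ^ n * c_d * (c_g * (1 / β) ^ q)) =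
      ENNReal.ofReal (2 ^ n) * ENNReal.ofReal c_d * ENNReal.ofReal (c_g * (1 / β) ^ q) := by
    rw [ENNReal.ofReal_mul' (by positivity), ENNReal.ofReal_mul (by positivity)]
  calc ∫⁻ x in closedBall z (2 * r), ENNReal.ofReal (Φ x (1 / r))
      = ∫⁻ x in ball z (2 * r), ENNReal.ofReal (Φ x (1 / r)) := setLIntegral_congr hae
    _ ≤ S * volume (ball z (2 * r)) := hupper
    _ ≤ ENNReal.ofReal c_d * I * (ENNReal.ofReal (2 ^ n) * volume (ball z r)) := by
      rw [hvol]; gcongr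
    _ = ENNReal.ofReal (2 ^ n) * ENNReal.ofReal c_d * (I * volume (ball z r)) := by ring
    _ ≤ ENNReal.ofReal (2 ^ n) * ENNReal.ofReal c_d *
        (ENNReal.ofReal (c_g * (1 / β) ^ q) * hIntE n Φ z r) := by gcongr
    _ = _ := by rw [hcc]; ring

/-- Lipschitz functions with values in `[0,N]`, supported in `V`, equal to `N` near `E`, whose
energy density is dominated by a measurable function of integral at most `M`. -/
structure IsEnergyTest {n : ℕ} (Ω : Set (EuclideanSpace ℝ (Fin n)))
    (Φ : EuclideanSpace ℝ (Fin n) → ℝ → ℝ) (E V : Set (EuclideanSpace ℝ (Fin n)))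
    (N : ℝ) (M : ℝ≥0∞) (f : EuclideanSpace ℝ (Fin n) → ℝ) : Prop where
  lipschitz : ∃ K, LipschitzWith K f
  mem_Icc : ∀ x, f x ∈ Set.Icc 0 N
  tsupport_subset : tsupport f ⊆ V
  eqOn : ∃ U, IsOpen U ∧ E ⊆ U ∧ ∀ x ∈ U, f x = N
  energy : ∃ G : EuclideanSpace ℝ (Fin n) → ℝ≥0∞, Measurable G ∧
    (∀ᵐ x ∂(volume : Measure (EuclideanSpace ℝ (Fin n))), x ∈ Ω →
      ENNReal.ofReal (Φ x ‖fderiv ℝ f x‖) ≤ G x) ∧ ∫⁻ x, G x ≤ M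

/-- If energy tests of height `1` and energy at most `M` exist in every neighbourhood of `E`,
then nesting them gives tests of height `N` and energy at most `N * M`. -/
lemma exists_isEnergyTest_natCast {n : ℕ} {Ω : Set (EuclideanSpace ℝ (Fin n))}
    {Φ : EuclideanSpace ℝ (Fin n) → ℝ → ℝ} {E : Set (EuclideanSpace ℝ (Fin n))} {M : ℝ≥0∞}
    (hzero : ∀ x ∈ Ω, Φ x 0 = 0)
    (h : ∀ V, IsOpen V → E ⊆ V → ∃ f, IsEnergyTest Ω Φ E V 1 M f) (N : ℕ) :
    ∀ V, IsOpen V → E ⊆ V → ∃ f, IsEnergyTest Ω Φ E V N (N * M) f := by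
  induction N with
  | zero =>
    intro V _ _
    refine ⟨fun _ => 0, ⟨0, LipschitzWith.const 0⟩, by simp, ?_,
      ⟨Set.univ, isOpen_univ, Set.subset_univ _, by simp⟩, fun _ => 0, measurable_const, ?_, ?_⟩
    · simp [tsupport, Function.support]
    · exact Eventually.of_forall fun x hx => by simp [hzero x hx]
    · simp
  | succ N ih =>
    intro V hV hEV
    obtain ⟨f, ⟨K, hK⟩, hf, hfV, ⟨U, hU, hEU, hfU⟩, G, hGm, hfG, hGM⟩ := h V hV hEV
    obtain ⟨g, ⟨L, hL⟩, hg, hgW, ⟨W, hW, hEW, hgW'⟩, H, hHm, hgH, hHM⟩ :=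
      ih (U ∩ V) (hU.inter hV) (Set.subset_inter hEU hEV)
    have hgU : tsupport g ⊆ U := hgW.trans Set.inter_subset_left
    refine ⟨fun x => f x + g x, ⟨_, hK.add hL⟩, fun x => ⟨add_nonneg (hf x).1 (hg x).1, ?_⟩, ?_,
      ⟨U ∩ W, hU.inter hW, Set.subset_inter hEU hEW, fun x hx => ?_⟩,
      fun x => G x + H x, hGm.add hHm, ?_, ?_⟩
    · push_cast
      linarith [(hf x).2, (hg x).2]
    · exact (tsupport_add f g).trans (Set.union_subset hfV (hgW.trans Set.inter_subset_right))
    · rw [hfU x hx.1, hgW' x hx.2]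
      push_cast
      ring
    · filter_upwards [hfG, hgH] with x hx hx' hxΩ
      by_cases hxU : x ∈ U
      · have heq : (fun y => f y + g y) =ᶠ[𝓝 x] fun y => 1 + g y := by
          filter_upwards [hU.mem_nhds hxU] with y hy
          rw [hfU y hy]
        rw [heq.fderiv_eq, fderiv_const_add]
        exact (hx' hxΩ).trans le_add_self
      · have heq : (fun y => f y + g y) =ᶠ[𝓝 x] f := by
          filter_upwards [notMem_tsupport_iff_eventuallyEq.1 fun h => hxU (hgU h)] with y hy
          simp [hy]
        rw [heq.fderiv_eq]
        exact (hx hxΩ).trans le_self_add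
    · rw [lintegral_add_left hGm]
      push_cast
      rw [add_mul, one_mul, add_comm]
      gcongr

/-- If `𝓗_Φ(E)` is finite, then every neighbourhood of `E` carries an energy test of height `1`
whose energy is bounded independently of the neighbourhood. -/
lemma exists_isEnergyTest_one {n : ℕ} {Ω : Set (EuclideanSpace ℝ (Fin n))} (hΩ : IsOpen Ω)
    {Φ : EuclideanSpace ℝ (Fin n) → ℝ → ℝ} (hmeas : ∀ t : ℝ, Measurable fun x => Φ x t)
    (hmono : ∀ᵐ x ∂(volume : Measure (EuclideanSpace ℝ (Fin n))), x ∈ Ω →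
      ∀ s t : ℝ, 0 ≤ s → s ≤ t → Φ x s ≤ Φ x t)
    (hzero : ∀ x ∈ Ω, Φ x 0 = 0) {A : ℝ≥0∞}
    (hballs : ∀ (z : EuclideanSpace ℝ (Fin n)) (r : ℝ), 0 < r → 2 * r ≤ 1 →
      ball z (2 * r) ⊆ Ω →
        ∫⁻ x in closedBall z (2 * r), ENNReal.ofReal (Φ x (1 / r)) ≤ A * hIntE n Φ z r)
    {E : Set (EuclideanSpace ℝ (Fin n))} (hE : IsCompact E) (hEΩ : E ⊆ Ω)
    (hfin : HIntMeasureIn n Ω Φ E < ⊤) (V : Set (EuclideanSpace ℝ (Fin n))) (hV : IsOpen V)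
    (hEV : E ⊆ V) :
    ∃ f, IsEnergyTest Ω Φ E V 1 (A * (HIntMeasureIn n Ω Φ E + 1)) f := by
  classical
  obtain ⟨δ, hδ, hδV⟩ := hE.exists_thickening_subset_open (hV.inter hΩ) (Set.subset_inter hEV hEΩ)
  set κ : ℝ := min (1 / 2) (δ / 3)
  have hκ : 0 < κ := by positivity
  have hκ1 : κ ≤ 1 / 2 := min_le_left _ _
  have hκδ : 3 * κ ≤ δ := by linarith [min_le_right (1 / 2) (δ / 3)]
  have hpre : HIntPreIn n Ω Φ κ E < HIntMeasureIn n Ω Φ E + 1 :=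
    (le_iSup₂ (f := fun (κ : ℝ) (_ : 0 < κ ∧ κ ≤ 1) => HIntPreIn n Ω Φ κ E) κ
      ⟨hκ, by linarith⟩).trans_lt (ENNReal.lt_add_right hfin.ne one_ne_zero)
  obtain ⟨c, hc, hsum⟩ : ∃ c, IsBallCoverIn n Ω κ E c ∧
      ∑' j, hIntE n Φ (c j).1 (c j).2 < HIntMeasureIn n Ω Φ E + 1 := by
    simpa only [HIntPreIn, iInf_lt_iff, exists_prop] using hpre
  obtain ⟨T, hT⟩ := hE.elim_finite_subcover _ (fun j => isOpen_ball) hc.2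
  set s := T.filter fun j => (ball (c j).1 (c j).2 ∩ E).Nonempty
  have hr : ∀ j ∈ s, 0 < (c j).2 := fun j hj => by
    obtain ⟨e, he, -⟩ := (Finset.mem_filter.1 hj).2
    exact pos_of_mem_ball he
  have hcl : ∀ j ∈ s, closedBall (c j).1 (2 * (c j).2) ⊆ V ∩ Ω := fun j hj y hy => by
    obtain ⟨e, he, heE⟩ := (Finset.mem_filter.1 hj).2
    refine hδV (mem_thickening_iff.2 ⟨e, heE, ?_⟩)
    have h1 := dist_triangle_right y e (c j).1
    have h2 := (hc.1 j).1
    rw [mem_ball] at he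
    rw [mem_closedBall] at hy
    linarith
  obtain ⟨f, hLip, hf01, hsupp, hone, hloc⟩ :=
    exists_cutoff_biUnion_ball s (fun j => (c j).1) (fun j => (c j).2) hr
  refine ⟨f, hLip, hf01, hsupp.trans (Set.iUnion₂_subset fun j hj =>
    (hcl j hj).trans Set.inter_subset_left),
    ⟨⋃ j ∈ s, ball (c j).1 (c j).2, isOpen_biUnion fun _ _ => isOpen_ball, fun x hx => ?_,
      fun x hx => ?_⟩,
    fun x => ∑ j ∈ s, (closedBall (c j).1 (2 * (c j).2)).indicator
      (fun x => ENNReal.ofReal (Φ x (1 / (c j).2))) x, ?_, ?_, ?_⟩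
  · obtain ⟨j, hj, hxj⟩ := Set.mem_iUnion₂.1 (hT hx)
    exact Set.mem_iUnion₂.2 ⟨j, Finset.mem_filter.2 ⟨hj, x, hxj, hx⟩, hxj⟩
  · obtain ⟨j, hj, hxj⟩ := Set.mem_iUnion₂.1 hx
    exact hone j hj x hxj
  · exact Finset.measurable_fun_sum _ fun j _ =>
      (hmeas _).ennreal_ofReal.indicator measurableSet_closedBall
  · filter_upwards [hmono] with x hx hxΩ
    obtain ⟨C, hC, hCx⟩ := hloc x
    have hC0 : 0 ≤ C := by
      rcases hC with rfl | ⟨j, hj, -, rfl⟩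
      · exact le_rfl
      · exact (one_div_pos.2 (hr j hj)).le
    have hD : ‖fderiv ℝ f x‖ ≤ C := norm_fderiv_le_of_lip' ℝ hC0 (by
      filter_upwards [hCx] with y hy
      rwa [Real.norm_eq_abs, ← dist_eq_norm])
    refine (ENNReal.ofReal_le_ofReal (hx hxΩ _ _ (norm_nonneg _) hD)).trans ?_
    rcases hC with rfl | ⟨j, hj, hxj, rfl⟩
    · simp [hzero x hxΩ]
    · refine le_trans (Eq.le ?_) (Finset.single_le_sum (fun _ _ => zero_le) hj)
      rw [Set.indicator_of_mem hxj]
  · rw [lintegral_finsetSum _ fun j _ =>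
      (hmeas _).ennreal_ofReal.indicator measurableSet_closedBall]
    calc _ ≤ ∑ j ∈ s, A * hIntE n Φ (c j).1 (c j).2 := by
          refine Finset.sum_le_sum fun j hj => ?_
          rw [lintegral_indicator measurableSet_closedBall]
          have h2 := (hc.1 j).1
          exact hballs _ _ (hr j hj) (by linarith)
            (ball_subset_closedBall.trans ((hcl j hj).trans Set.inter_subset_right))
      _ = A * ∑ j ∈ s, hIntE n Φ (c j).1 (c j).2 := (Finset.mul_sum _ _ _).symm
      _ ≤ _ := by
          gcongr
          exact (ENNReal.sum_le_tsum s).trans hsum.le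

/-- Theorem 1.4: `𝓗_Φ(E) < ∞` implies `Cap_Φ(E) = 0`, stated via the
Lipschitz test functions constructed in its proof. If `E ⊆ Ω` is compact with
`𝓗_Φ(E) < ∞`, then for every `ε > 0` there is a Lipschitz `f : ℝⁿ → [0,1]` with compact
support in `Ω`, `f = 1` on an open neighborhood of `E`, and `∫_Ω Φ(x, ‖Df x‖) dx < ε`,
where `Df` is the Fréchet derivative (set to `0` at points of non-differentiability, as
is the convention for `fderiv`). -/
theorem stmt_8 (n : ℕ) (Ω : Set (EuclideanSpace ℝ (Fin n))) (hΩ : IsOpen Ω)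
    (hΩb : Bornology.IsBounded Ω)
    (Φ : EuclideanSpace ℝ (Fin n) → ℝ → ℝ)
    (hmeas : ∀ t : ℝ, Measurable fun x => Φ x t)
    (hnonneg : ∀ x ∈ Ω, ∀ t : ℝ, 0 ≤ t → 0 ≤ Φ x t)
    (hcar : ∀ᵐ x ∂(volume : Measure (EuclideanSpace ℝ (Fin n))), x ∈ Ω →
      ContinuousOn (Φ x) (Set.Ici 0) ∧ ∀ s t : ℝ, 0 ≤ s → s ≤ t → Φ x s ≤ Φ x t)
    (hzero : ∀ x ∈ Ω, Φ x 0 = 0)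
    (p q c_g : ℝ) (hp : 1 < p) (hpq : p < q) (hcg : 1 ≤ c_g)
    (hgrowth : ∀ᵐ x ∂(volume : Measure (EuclideanSpace ℝ (Fin n))), x ∈ Ω →
      ∀ s t : ℝ, 0 < s → s ≤ t →
        Φ x s / s ^ p ≤ c_g * (Φ x t / t ^ p) ∧ Φ x t / t ^ q ≤ c_g * (Φ x s / s ^ q))
    (β₄ c_d : ℝ) (hβ : 0 < β₄) (hβ1 : β₄ ≤ 1) (hcd : 1 ≤ c_d)
    (hbal : ∀ (z : EuclideanSpace ℝ (Fin n)) (r : ℝ), 0 < r → r ≤ 1 → ball z r ⊆ Ω →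
      ∀ t : ℝ, 1 ≤ t → t ≤ 2 / (β₄ * r) →
        essSup (fun x => ENNReal.ofReal (Φ x (β₄ * t))) (volume.restrict (ball z r)) ≤
          ENNReal.ofReal c_d *
            essInf (fun x => ENNReal.ofReal (Φ x t)) (volume.restrict (ball z r)))
    (E : Set (EuclideanSpace ℝ (Fin n))) (hE : IsCompact E) (hEΩ : E ⊆ Ω)
    (hfin : HIntMeasureIn n Ω Φ E < ⊤) :
    ∀ ε : ℝ, 0 < ε →
      ∃ (f : EuclideanSpace ℝ (Fin n) → ℝ) (K : ℝ≥0),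
        LipschitzWith K f ∧
        (∀ x, f x ∈ Set.Icc (0 : ℝ) 1) ∧
        HasCompactSupport f ∧
        tsupport f ⊆ Ω ∧
        (∃ U : Set (EuclideanSpace ℝ (Fin n)), IsOpen U ∧ E ⊆ U ∧ Set.EqOn f 1 U) ∧
        ∫⁻ x in Ω, ENNReal.ofReal (Φ x ‖fderiv ℝ f x‖) < ENNReal.ofReal ε := by
  have hgrowthq : ∀ᵐ x ∂(volume : Measure (EuclideanSpace ℝ (Fin n))), x ∈ Ω →
      ∀ s t : ℝ, 0 < s → s ≤ t → Φ x t / t ^ q ≤ c_g * (Φ x s / s ^ q) := by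
    filter_upwards [hgrowth] with x hx hxΩ s t hs hst using (hx hxΩ s t hs hst).2
  have hballs : ∀ (z : EuclideanSpace ℝ (Fin n)) (r : ℝ), 0 < r → 2 * r ≤ 1 →
      ball z (2 * r) ⊆ Ω → ∫⁻ x in closedBall z (2 * r), ENNReal.ofReal (Φ x (1 / r)) ≤
        ENNReal.ofReal (2 ^ n * c_d * (c_g * (1 / β₄) ^ q)) * hIntE n Φ z r := by
    intro z r hr hr1 hz
    refine lintegral_closedBall_two_mul_le (by linarith) hβ hβ1 hr ?_
      (hbal z (2 * r) (by positivity) hr1 hz (1 / (β₄ * r)) ?_ ?_)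
    · filter_upwards [hgrowthq] with x hx hxr
      exact hx (hz (ball_subset_ball (by linarith) hxr))
    · rw [le_div_iff₀ (by positivity), one_mul]
      exact mul_le_one₀ hβ1 hr.le (by linarith)
    · exact Eq.le (by field_simp)
  have hmono : ∀ᵐ x ∂(volume : Measure (EuclideanSpace ℝ (Fin n))), x ∈ Ω →
      ∀ s t : ℝ, 0 ≤ s → s ≤ t → Φ x s ≤ Φ x t := by
    filter_upwards [hcar] with x hx hxΩ using (hx hxΩ).2
  set M : ℝ≥0∞ := ENNReal.ofReal (2 ^ n * c_d * (c_g * (1 / β₄) ^ q)) *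
    (HIntMeasureIn n Ω Φ E + 1)
  have hM : M ≠ ⊤ :=
    ENNReal.mul_ne_top ENNReal.ofReal_ne_top (ENNReal.add_ne_top.2 ⟨hfin.ne, ENNReal.one_ne_top⟩)
  have hone := exists_isEnergyTest_one hΩ hmeas hmono hzero hballs hE hEΩ hfin
  intro ε hε
  obtain ⟨N, hN, hNε⟩ : ∃ N : ℕ, 0 < N ∧ c_g * M.toReal * (N : ℝ) ^ (-(p - 1)) < ε := by
    have ht : Tendsto (fun N : ℕ => c_g * M.toReal * (N : ℝ) ^ (-(p - 1))) atTop (𝓝 0) := by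
      simpa using ((tendsto_rpow_neg_atTop (sub_pos.2 hp)).comp
        tendsto_natCast_atTop_atTop).const_mul (c_g * M.toReal)
    exact ((eventually_gt_atTop 0).and (ht.eventually_lt_const hε)).exists
  have hN0 : (0 : ℝ) < N := by exact_mod_cast hN
  obtain ⟨g, ⟨K, hK⟩, hg, hgΩ, ⟨U, hU, hEU, hgU⟩, G, -, hgG, hGM⟩ :=
    exists_isEnergyTest_natCast hzero hone N Ω hΩ hEΩ
  have hsupp : tsupport (fun x => (N : ℝ)⁻¹ • g x) ⊆ Ω :=
    (closure_mono (Function.support_const_smul_subset (N : ℝ)⁻¹ g)).trans hgΩ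
  refine ⟨fun x => (N : ℝ)⁻¹ • g x, _, (lipschitzWith_smul (N : ℝ)⁻¹).comp hK, fun x => ⟨?_, ?_⟩,
    isCompact_of_isClosed_isBounded (isClosed_tsupport _) (hΩb.subset hsupp), hsupp,
    ⟨U, hU, hEU, fun x hx => ?_⟩, ?_⟩
  · exact mul_nonneg (by positivity) (hg x).1
  · change (N : ℝ)⁻¹ * g x ≤ 1
    rw [inv_mul_le_iff₀ hN0, mul_one]
    exact (hg x).2
  · simp [hgU x hx, hN0.ne']
  have hpt : ∀ᵐ x ∂volume.restrict Ω,
      ENNReal.ofReal (Φ x ‖fderiv ℝ (fun x => (N : ℝ)⁻¹ • g x) x‖) ≤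
        ENNReal.ofReal (c_g * (N : ℝ) ^ (-p)) * G x := by
    filter_upwards [ae_restrict_of_ae hgrowth, ae_restrict_of_ae hgG,
      ae_restrict_mem hΩ.measurableSet] with x hgr hGx hxΩ
    rw [show (fun x => (N : ℝ)⁻¹ • g x) = (N : ℝ)⁻¹ • g from rfl, fderiv_const_smul_field,
      Pi.smul_apply, norm_smul, norm_inv, Real.norm_natCast]
    refine le_trans ?_ (mul_le_mul_right (hGx hxΩ) _)
    rw [← ENNReal.ofReal_mul (by positivity)]
    refine ENNReal.ofReal_le_ofReal ?_
    have hs0 := norm_nonneg (fderiv ℝ g x)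
    generalize ‖fderiv ℝ g x‖ = s at hs0
    rcases hs0.eq_or_lt with rfl | hs
    · simp [hzero x hxΩ]
    · have h := (hgr hxΩ ((N : ℝ)⁻¹ * s) s (by positivity)
        (mul_le_of_le_one_left hs.le (inv_le_one_of_one_le₀ (by exact_mod_cast hN)))).1
      rw [div_le_iff₀ (by positivity)] at h
      refine h.trans_eq ?_
      rw [Real.mul_rpow (by positivity) hs.le, Real.inv_rpow hN0.le, Real.rpow_neg hN0.le]
      have : s ^ p ≠ 0 := by positivity
      field_simp
  calc ∫⁻ x in Ω, ENNReal.ofReal (Φ x ‖fderiv ℝ (fun x => (N : ℝ)⁻¹ • g x) x‖)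
      ≤ ∫⁻ x in Ω, ENNReal.ofReal (c_g * (N : ℝ) ^ (-p)) * G x := lintegral_mono_ae hpt
    _ ≤ ∫⁻ x, ENNReal.ofReal (c_g * (N : ℝ) ^ (-p)) * G x := setLIntegral_le_lintegral _ _
    _ = ENNReal.ofReal (c_g * (N : ℝ) ^ (-p)) * ∫⁻ x, G x :=
      lintegral_const_mul' _ _ ENNReal.ofReal_ne_top
    _ ≤ ENNReal.ofReal (c_g * (N : ℝ) ^ (-p)) * (N * M) := by gcongr
    _ = ENNReal.ofReal (c_g * M.toReal * (N : ℝ) ^ (-(p - 1))) := by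
      rw [← ENNReal.ofReal_toReal hM, ← ENNReal.ofReal_natCast, ENNReal.toReal_ofReal (by positivity),
        ← ENNReal.ofReal_mul hN0.le, ← ENNReal.ofReal_mul (by positivity),
        show -(p - 1) = -p + 1 by ring, Real.rpow_add_one hN0.ne']
      ring_nf
    _ < ENNReal.ofReal ε := (ENNReal.ofReal_lt_ofReal_iff hε).2 hNε
end

section
/- Let n ≥ 1, α ∈ (0,1], M ≥ 0, and let a : ℝⁿ → [0,∞) satisfy |a(x) − a(y)| ≤ M·|x−y|^α for all x, y. Let B ⊆ ℝⁿ be a ball of radius r ≤ 1 and let τ ∈ [0, α]. Then: (i) if inf_{x∈B} a(x) ≤ 4M·r^τ, then sup_{x∈B} a(x) ≤ 6M·r^τ; and (ii) if inf_{x∈B} a(x) ≥ 4M·r^τ, then sup_{x∈B} a(x) ≤ (3/2)·inf_{x∈B} a(x). -/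
/-- The oscillation of a Hölder function with exponent `α ≤ 1` on a ball of radius `r ≤ 1` is at
most `2 * M * r ^ τ`, for every `τ ≤ α`. -/
theorem sSup_image_ball_le_sInf_add {E : Type*} [SeminormedAddCommGroup E] {α M τ r : ℝ}
    {a : E → ℝ} {z : E} (hα : 0 ≤ α) (hα1 : α ≤ 1) (hM : 0 ≤ M)
    (hHol : ∀ x y, |a x - a y| ≤ M * ‖x - y‖ ^ α) (hr : 0 < r) (hr1 : r ≤ 1) (hτα : τ ≤ α) :
    sSup (a '' Metric.ball z r) ≤ sInf (a '' Metric.ball z r) + 2 * M * r ^ τ := by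
  have hne : (a '' Metric.ball z r).Nonempty := (Metric.nonempty_ball.2 hr).image a
  have hpow : (2 * r) ^ α ≤ 2 * r ^ τ := by
    rw [Real.mul_rpow zero_le_two hr.le]
    have h2 : (2 : ℝ) ^ α ≤ 2 := by
      simpa using Real.rpow_le_rpow_of_exponent_le one_le_two hα1
    exact mul_le_mul h2 (Real.rpow_le_rpow_of_exponent_ge hr hr1 hτα) (by positivity) zero_le_two
  have hosc : ∀ x ∈ Metric.ball z r, ∀ y ∈ Metric.ball z r, a x ≤ a y + 2 * M * r ^ τ := by
    intro x hx y hy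
    have hxy : ‖x - y‖ ≤ 2 * r := by
      rw [← dist_eq_norm]
      linarith [dist_triangle_right x y z, Metric.mem_ball.1 hx, Metric.mem_ball.1 hy]
    have hbound : M * ‖x - y‖ ^ α ≤ M * (2 * r ^ τ) :=
      mul_le_mul_of_nonneg_left
        ((Real.rpow_le_rpow (norm_nonneg _) hxy hα).trans hpow) hM
    linarith [le_abs_self (a x - a y), hHol x y]
  refine csSup_le hne ?_
  rintro _ ⟨x, hx, rfl⟩
  rw [← sub_le_iff_le_add]
  refine le_csInf hne ?_
  rintro _ ⟨y, hy, rfl⟩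
  exact sub_le_iff_le_add.2 (hosc x hx y hy)


/-- phase dichotomy, display (a) in Step 5 of the proof of Theorem
1.1. For an `α`-Hölder coefficient `a ≥ 0` with constant `M`, a ball of radius
`r ≤ 1` and `τ ∈ [0,α]`: (i) if `inf_B a ≤ 4M r^τ` then `sup_B a ≤ 6M r^τ`;
(ii) if `inf_B a ≥ 4M r^τ` then `sup_B a ≤ (3/2) inf_B a`. -/
theorem stmt_19 (n : ℕ) (hn : 1 ≤ n) (α M : ℝ)
    (hα : 0 < α) (hα1 : α ≤ 1) (hM : 0 ≤ M)
    (a : EuclideanSpace ℝ (Fin n) → ℝ) (ha0 : ∀ x, 0 ≤ a x)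
    (hHol : ∀ x y, |a x - a y| ≤ M * ‖x - y‖ ^ α)
    (z : EuclideanSpace ℝ (Fin n)) (r : ℝ) (hr : 0 < r) (hr1 : r ≤ 1)
    (τ : ℝ) (hτ : 0 ≤ τ) (hτα : τ ≤ α) :
    (sInf (a '' Metric.ball z r) ≤ 4 * M * r ^ τ →
      sSup (a '' Metric.ball z r) ≤ 6 * M * r ^ τ) ∧
    (4 * M * r ^ τ ≤ sInf (a '' Metric.ball z r) →
      sSup (a '' Metric.ball z r) ≤ (3 / 2) * sInf (a '' Metric.ball z r)) := by
  have h := sSup_image_ball_le_sInf_add (z := z) hα.le hα1 hM hHol hr hr1 hτα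
  exact ⟨fun _ => by linarith, fun _ => by linarith⟩
end
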